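/- Brieskorn–Saito normal form: let M(S) be an Artin monoid. For every w ∈ M(S) there exist a unique k ≥ 0 and unique nonempty subsets I_k, …, I_1 ⊆ S, each admitting a left least common multiple Δ_{I_j}, such that w = Δ_{I_k} · Δ_{I_{k-1}} ⋯ Δ_{I_2} · Δ_{I_1} and such that for each 1 ≤ j ≤ k the set I(Δ_{I_k} ⋯ Δ_{I_j}) of letters a ∈ S with which the element Δ_{I_k} ⋯ Δ_{I_j} can end (i.e. a is a right divisor) equals I_j. -/

import Mathlib

/-- The alternating word `sts…` with `m` letters. -/
def altWord {S : Type*} (s t : S) : ℕ → List S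
  | 0 => []
  | n + 1 => s :: altWord t s n

theorem altWord_map {S T : Type*} (f : S → T) (s t : S) (k : ℕ) :
    (altWord s t k).map f = altWord (f s) (f t) k := by
  induction k generalizing s t with
  | zero => rfl
  | succ n ih => simp [altWord, ih]

/-- A Coxeter matrix on `S`, with `⊤ : ℕ∞` meaning no relation. -/
structure CoxeterMat (S : Type*) where
  m : S → S → ℕ∞
  diag : ∀ s, m s s = 1
  symm : ∀ s t, m s t = m t s
  two_le : ∀ s t, s ≠ t → 2 ≤ m s t

variable {S : Type*}

/-- The braid relations of the Artin monoid presentation. -/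
def artinRel (M : CoxeterMat S) : FreeMonoid S → FreeMonoid S → Prop := fun a b =>
  ∃ (s t : S) (k : ℕ), s ≠ t ∧ M.m s t = (k : ℕ∞) ∧
    a = FreeMonoid.ofList (altWord s t k) ∧ b = FreeMonoid.ofList (altWord t s k)

/-- The Artin monoid of a Coxeter matrix. -/
abbrev ArtinMonoid (M : CoxeterMat S) : Type _ := PresentedMonoid (artinRel M)

/-- The canonical generators of the Artin monoid. -/
abbrev ArtinMonoid.of (M : CoxeterMat S) (s : S) : ArtinMonoid M :=
  PresentedMonoid.of (artinRel M) s

/-- Restriction of a Coxeter matrix to a subset. -/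
def CoxeterMat.restrict (M : CoxeterMat S) (T : Set S) : CoxeterMat T where
  m s t := M.m s t
  diag s := M.diag s
  symm s t := M.symm s t
  two_le s t h := M.two_le s t (fun hc => h (Subtype.ext hc))

theorem presentedMonoid_mk_ofList_map {α β : Type*} {rels : FreeMonoid β → FreeMonoid β → Prop}
    (φ : α → β) (l : List α) :
    FreeMonoid.lift (fun a => PresentedMonoid.of rels (φ a)) (FreeMonoid.ofList l)
      = PresentedMonoid.mk rels (FreeMonoid.ofList (l.map φ)) := by
  induction l with
  | nil => rfl
  | cons x l ih =>
      rw [show FreeMonoid.ofList (x :: l) = FreeMonoid.of x * FreeMonoid.ofList l from rfl,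
        map_mul, ih]
      rfl

/-- The monoid homomorphism between Artin monoids induced by a map of generating sets
compatible with the Coxeter matrices. -/
def ArtinMonoid.mapOf {A B : Type*} {MA : CoxeterMat A} {MB : CoxeterMat B} (φ : A → B)
    (hm : ∀ a a', MA.m a a' = MB.m (φ a) (φ a')) :
    ArtinMonoid MA →* ArtinMonoid MB := by
  refine PresentedMonoid.lift (fun a => PresentedMonoid.of (artinRel MB) (φ a)) ?_
  rintro a b ⟨s, t, k, hst, hk, rfl, rfl⟩
  have hne : φ s ≠ φ t := by
    intro hc
    have h1 : MB.m (φ s) (φ t) = 1 := by rw [hc, MB.diag]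
    have h2 := MA.two_le s t hst
    rw [hm s t, h1] at h2
    exact absurd h2 (by decide)
  rw [presentedMonoid_mk_ofList_map, presentedMonoid_mk_ofList_map,
    altWord_map, altWord_map]
  exact Quotient.sound (ConGen.Rel.of _ _ ⟨φ s, φ t, k, hne, by rw [← hm s t]; exact hk, rfl, rfl⟩)

/-- The canonical homomorphism `M(T) → M(T')` for `T ⊆ T'`. -/
def ArtinMonoid.incl (M : CoxeterMat S) {T T' : Set S} (h : T ⊆ T') :
    ArtinMonoid (M.restrict T) →* ArtinMonoid (M.restrict T') :=
  ArtinMonoid.mapOf (Set.inclusion h) (fun _ _ => rfl)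

/-- The canonical homomorphism `M(T) → M(S)`. -/
def ArtinMonoid.ι (M : CoxeterMat S) (T : Set S) :
    ArtinMonoid (M.restrict T) →* ArtinMonoid M :=
  ArtinMonoid.mapOf Subtype.val (fun _ _ => rfl)

/-- `d` is a left least common multiple of the images in `M(S)` of the generators in `J`. -/
def IsLeftLcmOfSet {S : Type*} (M : CoxeterMat S) (J : Set S) (d : ArtinMonoid M) : Prop :=
  (∀ s ∈ J, ∃ u, d = u * ArtinMonoid.of M s) ∧
    ∀ c : ArtinMonoid M, (∀ s ∈ J, ∃ u, c = u * ArtinMonoid.of M s) → ∃ e, c = e * d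

/-- The set `I(x)` of letters with which `x` may end (on the right). -/
def endLetters {S : Type*} (M : CoxeterMat S) (x : ArtinMonoid M) : Set S :=
  { a | ∃ y, x = y * ArtinMonoid.of M a }

/-! ### The geometric representation of a Coxeter group -/

namespace CoxeterMatrix

open Real Polynomial.Chebyshev

variable {B : Type*} (M : CoxeterMatrix B)

/-- The entries `-2 cos (π / M i j)` of the Cartan matrix of the geometric representation;
an infinite label, encoded by `M i j = 0`, gives the entry `-2`. -/
noncomputable def cartan (i j : B) : ℝ := -2 * cos (π / M i j)

/-- The linear form on `B →₀ ℝ` given by a row of the Cartan matrix. -/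
noncomputable def coroot (i : B) : Module.Dual ℝ (B →₀ ℝ) :=
  Finsupp.linearCombination ℝ (M.cartan i)

theorem coroot_single (i j : B) : M.coroot i (Finsupp.single j 1) = M.cartan i j := by
  simp [coroot]

theorem coroot_self (i : B) : M.coroot i (Finsupp.single i 1) = 2 := by
  simp [coroot_single, cartan]

theorem cartan_symm (i j : B) : M.cartan i j = M.cartan j i := by
  rw [cartan, cartan, M.symmetric]

theorem cartan_mul_cartan (i j : B) :
    M.cartan i j * M.cartan j i - 2 = 2 * cos (2 * (π / M i j)) := by
  rw [M.cartan_symm j i, cartan, cos_two_mul]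
  ring

/-- The simple reflections of the geometric representation. -/
noncomputable def geomReflection (i : B) : (B →₀ ℝ) ≃ₗ[ℝ] (B →₀ ℝ) :=
  Module.reflection (M.coroot_self i)

theorem three_le_of_ne {i j : B} (h : i ≠ j) (h0 : M i j ≠ 0) (h2 : M i j ≠ 2) :
    3 ≤ M i j := by
  have := M.off_diagonal i j h
  lia

theorem sin_two_mul_pi_div_pos {m : ℕ} (hm : 3 ≤ m) : 0 < sin (2 * (π / m)) := by
  have hm' : (3 : ℝ) ≤ m := mod_cast hm
  have h3 : π / m ≤ π / 3 := by gcongr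
  have h0 : 0 < π / m := by positivity
  exact sin_pos_of_pos_of_lt_pi (by linarith) (by linarith [pi_pos])

theorem isLiftable_geomReflection : M.IsLiftable M.geomReflection := by
  intro i j
  rcases eq_or_ne i j with rfl | hij
  · rw [M.diagonal, pow_one]
    ext1 x
    exact Module.involutive_reflection (M.coroot_self i) x
  rcases eq_or_ne (M i j) 0 with h0 | h0
  · rw [h0, pow_zero]
  ext1 x
  have key := Module.reflection_mul_reflection_pow_apply (M.coroot_self i) (M.coroot_self j)
    (M i j) x (2 * cos (2 * (π / M i j)))
    (by rw [coroot_single, coroot_single, cartan_mul_cartan])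
  refine key.trans ?_
  rw [coroot_single, coroot_single]
  rcases eq_or_ne (M i j) 2 with h2 | h2
  · have hc : M.cartan i j = 0 := by simp [cartan, h2]
    have hc' : M.cartan j i = 0 := by rw [cartan_symm, hc]
    have ht : 2 * cos (2 * (π / (2 : ℕ))) = -2 := by
      rw [show 2 * (π / (2 : ℕ)) = π by push_cast; ring, cos_pi]
      norm_num
    rw [h2, hc, hc', ht]
    norm_num
    module
  have h3 := M.three_le_of_ne hij h0 h2
  have hs := (sin_two_mul_pi_div_pos h3).ne'
  have hS := fun n : ℤ => S_two_mul_real_cos (2 * (π / M i j)) n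
  set m := M i j with hm
  have hm0 : (m : ℝ) ≠ 0 := by exact_mod_cast h0
  set φ := 2 * (π / m) with hφ
  obtain ⟨p, hp | hp⟩ := m.even_or_odd'
  · have h1 : ((m : ℤ) - 2) / 2 = p - 1 := by lia
    have h2 : ((m : ℤ) - 1) / 2 = p - 1 := by lia
    have hp0 : (p : ℝ) ≠ 0 := by
      rintro h
      simp [hp, h] at hm0
    have hz : (S ℝ (p - 1)).eval (2 * cos φ) = 0 := by
      have := hS (p - 1)
      rw [show (((p - 1 : ℤ) : ℝ) + 1) * φ = π by
        rw [hφ, hp]; push_cast; field_simp; ring, sin_pi] at this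
      exact (mul_eq_zero.1 this).resolve_right hs
    rw [h1, h2, hz]
    simp
  · have h1 : ((m : ℤ) - 2) / 2 = p - 1 := by lia
    have h2 : ((m : ℤ) - 1) / 2 = p := by lia
    have h3' : ((m : ℤ) - 3) / 2 = p - 1 := by lia
    have h4 : (m : ℤ) / 2 = p := by lia
    have hz : (S ℝ p).eval (2 * cos φ) + (S ℝ (p - 1)).eval (2 * cos φ) = 0 := by
      refine (mul_eq_zero.1 (?_ : _ * sin φ = 0)).resolve_right hs
      rw [add_mul, hS, hS, show (((p - 1 : ℤ) : ℝ) + 1) * φ = 2 * π - (((p : ℤ) : ℝ) + 1) * φ by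
        rw [hφ, hp]; push_cast; rw [hp] at hm0; push_cast at hm0; field_simp; ring, sin_two_pi_sub]
      ring
    rw [h1, h2, h3', h4, hz]
    simp

theorem geomReflection_mul_pow_ne_one {i j : B} (hij : i ≠ j) {n : ℕ} (hn : n ≠ 0)
    (hlt : M i j = 0 ∨ n < M i j) : (M.geomReflection i * M.geomReflection j) ^ n ≠ 1 := by
  intro h
  have key := Module.reflection_mul_reflection_pow_apply_self (M.coroot_self i) (M.coroot_self j)
    n (2 * cos (2 * (π / M i j)))
    (by rw [coroot_single, coroot_single, cartan_mul_cartan])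
  rw [show (Module.reflection (M.coroot_self i) * Module.reflection (M.coroot_self j)) ^ n = 1
    from h] at key
  have hi := DFunLike.congr_fun key i
  have hj := DFunLike.congr_fun key j
  simp [coroot_single, hij, hij.symm] at hi hj
  rcases eq_or_ne (M i j) 0 with h0 | h0
  · simp [h0] at hi
    have : (n : ℝ) ≠ 0 := by exact_mod_cast hn
    apply this
    linarith
  have hlt' := hlt.resolve_left h0
  rcases eq_or_ne (M i j) 2 with h2 | h2
  · have hn1 : n = 1 := by lia
    have ht : 2 * cos (2 * (π / (2 : ℕ))) = -2 := by
      rw [show 2 * (π / (2 : ℕ)) = π by push_cast; ring, cos_pi]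
      norm_num
    rw [h2, ht, hn1] at hi
    norm_num at hi
  have h3 := M.three_le_of_ne hij h0 h2
  have hs := (sin_two_mul_pi_div_pos h3).ne'
  have hS := fun n : ℤ => S_two_mul_real_cos (2 * (π / M i j)) n
  have hc : M.cartan j i ≠ 0 := by
    intro hc
    have := M.cartan_mul_cartan i j
    rw [hc, M.cartan_symm, hc] at this
    have hcos : cos (2 * (π / M i j)) = -1 := by linarith
    have := sin_sq_add_cos_sq (2 * (π / M i j))
    rw [hcos] at this
    exact hs (by simpa using this)
  have hz := hj.resolve_right hc
  have e1 := hS n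
  have e2 := hS (n - 1)
  rw [hz] at e2 hi
  rw [add_zero] at hi
  rw [← hi, one_mul] at e1
  push_cast at e1 e2
  rw [zero_mul, sub_add_cancel] at e2
  rw [add_mul, sin_add, ← e2, one_mul, zero_mul, zero_add] at e1
  have hcos : cos (n * (2 * (π / M i j))) = 1 := by
    exact mul_right_cancel₀ hs (by rw [← e1, one_mul])
  obtain ⟨k, hk⟩ := (cos_eq_one_iff _).1 hcos
  have hm0 : (M i j : ℝ) ≠ 0 := by exact_mod_cast h0
  have hkm : (k : ℝ) * M i j = n := by
    field_simp at hk
    linarith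
  have hkm' : k * (M i j : ℤ) = n := by exact_mod_cast hkm
  have hdvd : M i j ∣ n := Int.natCast_dvd_natCast.1 ⟨k, by rw [← hkm', mul_comm]⟩
  exact absurd (Nat.le_of_dvd (Nat.pos_of_ne_zero hn) hdvd) (by lia)

end CoxeterMatrix

/-- The product of two distinct simple reflections has order exactly `M i j`. -/
theorem CoxeterSystem.simple_mul_simple_pow_ne_one {B W : Type*} [Group W] {M : CoxeterMatrix B}
    (cs : CoxeterSystem M W) {i j : B} (hij : i ≠ j) {n : ℕ} (hn : n ≠ 0)
    (hlt : M i j = 0 ∨ n < M i j) : (cs.simple i * cs.simple j) ^ n ≠ 1 := by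
  intro h
  apply M.geomReflection_mul_pow_ne_one hij hn hlt
  have := congrArg (cs.lift ⟨M.geomReflection, M.isLiftable_geomReflection⟩) h
  simpa using this

/-! ### The exchange property -/

theorem Function.End.mul_apply {α : Type*} (f g : Function.End α) (a : α) :
    (f * g) a = f (g a) := rfl

theorem Function.End.one_apply {α : Type*} (a : α) : (1 : Function.End α) a = a := rfl

namespace CoxeterSystem

variable {B W : Type*} [Group W] {M : CoxeterMatrix B} (cs : CoxeterSystem M W)

open Classical in
/-- The action of a simple reflection on the signed elements of the group: conjugation, together
with a change of sign at the simple reflection itself. -/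
noncomputable def signedConj (i : B) : Function.End (W × ZMod 2) := fun p =>
  (cs.simple i * p.1 * cs.simple i, p.2 + if p.1 = cs.simple i then 1 else 0)

theorem pow_inv_mul_simple (i j : B) (n : ℕ) :
    ((cs.simple i * cs.simple j) ^ n)⁻¹ * cs.simple j =
      cs.simple j * (cs.simple i * cs.simple j) ^ n := by
  rw [← inv_pow, mul_inv_rev, inv_simple, inv_simple, mul_pow_mul]

open Classical in
theorem signedConj_mul_pow (i j : B) (n : ℕ) (x : W) (e : ZMod 2) :
    ((cs.signedConj i * cs.signedConj j) ^ n) (x, e) =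
      ((cs.simple i * cs.simple j) ^ n * x * ((cs.simple i * cs.simple j) ^ n)⁻¹,
        e + ∑ k ∈ Finset.range (2 * n),
          if x = cs.simple j * (cs.simple i * cs.simple j) ^ k then 1 else 0) := by
  induction n with
  | zero => simp; rfl
  | succ n ih =>
    rw [pow_succ', Function.End.mul_apply, ih, Function.End.mul_apply,
      show 2 * (n + 1) = 2 * n + 1 + 1 by ring, Finset.sum_range_succ, Finset.sum_range_succ]
    have key := cs.pow_inv_mul_simple i j n
    set r := cs.simple i * cs.simple j with hr
    have h1 : r ^ n * x * (r ^ n)⁻¹ = cs.simple j ↔ x = cs.simple j * r ^ (2 * n) := by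
      rw [mul_inv_eq_iff_eq_mul, ← eq_inv_mul_iff_mul_eq, ← mul_assoc, key, mul_assoc, ← pow_add,
        two_mul]
    have h2 : cs.simple j * (r ^ n * x * (r ^ n)⁻¹) * cs.simple j = cs.simple i ↔
        x = cs.simple j * r ^ (2 * n + 1) := by
      have : cs.simple j * cs.simple i * cs.simple j = cs.simple j * r := by rw [hr, mul_assoc]
      rw [← eq_mul_inv_iff_mul_eq, cs.inv_simple, ← eq_inv_mul_iff_mul_eq, cs.inv_simple,
        mul_inv_eq_iff_eq_mul, ← eq_inv_mul_iff_mul_eq, ← hr, mul_assoc, ← mul_assoc, key,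
        mul_assoc, ← pow_succ', ← pow_add]
      rw [show n + (n + 1) = 2 * n + 1 by ring]
    simp only [signedConj, h1, h2, Prod.mk.injEq]
    refine ⟨?_, by ring⟩
    rw [pow_succ', mul_inv_rev, hr, mul_inv_rev, cs.inv_simple, cs.inv_simple]
    simp only [mul_assoc]

theorem isLiftable_signedConj : M.IsLiftable cs.signedConj := by
  classical
  intro i j
  funext ⟨x, e⟩
  rw [signedConj_mul_pow, cs.simple_mul_simple_pow, two_mul, Finset.sum_range_add]
  simp only [pow_add, cs.simple_mul_simple_pow, one_mul, CharTwo.add_self_eq_zero]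
  simp
  rfl

/-- The sign action of the group on signed elements. -/
noncomputable def signedAction : W →* Function.End (W × ZMod 2) :=
  cs.lift ⟨cs.signedConj, cs.isLiftable_signedConj⟩

/-- The inversion cocycle: on a reflection `t` it equals `1` when `t` is a right inversion
of `w`. -/
noncomputable def inversionSign (w t : W) : ZMod 2 := (cs.signedAction w (t, 0)).2

theorem signedAction_apply (w t : W) (e : ZMod 2) :
    cs.signedAction w (t, e) = (w * t * w⁻¹, e + cs.inversionSign w t) := by
  classical
  unfold inversionSign
  induction w using cs.simple_induction_left generalizing t e with
  | one => rw [map_one]; simp [Function.End.one_apply]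
  | mul_simple_left w i ih =>
    have h : ∀ e, cs.signedAction (cs.simple i * w) (t, e) =
        cs.signedConj i (cs.signedAction w (t, e)) := by
      intro e
      rw [map_mul, Function.End.mul_apply]
      exact congrFun (cs.lift_apply_simple cs.isLiftable_signedConj i) _
    rw [h, h, ih t e, ih t 0]
    simp [signedConj, mul_assoc, add_assoc]

@[simp]
theorem inversionSign_one (t : W) : cs.inversionSign 1 t = 0 := by
  rw [inversionSign, map_one]; rfl

theorem inversionSign_mul (v w t : W) :
    cs.inversionSign (v * w) t = cs.inversionSign w t + cs.inversionSign v (w * t * w⁻¹) := by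
  have h : cs.signedAction (v * w) (t, 0) = cs.signedAction v (cs.signedAction w (t, 0)) := by
    rw [map_mul]; rfl
  rw [inversionSign, h, cs.signedAction_apply w, cs.signedAction_apply v, zero_add]

open Classical in
theorem inversionSign_simple (i : B) (t : W) :
    cs.inversionSign (cs.simple i) t = if t = cs.simple i then 1 else 0 := by
  rw [inversionSign, signedAction, cs.lift_apply_simple]
  simp [signedConj]

theorem mem_rightInvSeq_of_inversionSign_ne_zero {ω : List B} {t : W}
    (h : cs.inversionSign (cs.wordProd ω) t ≠ 0) : t ∈ cs.rightInvSeq ω := by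
  classical
  induction ω with
  | nil => simp at h
  | cons i ω ih =>
    rw [wordProd_cons, inversionSign_mul, inversionSign_simple] at h
    rw [rightInvSeq, List.mem_cons]
    by_cases hi : cs.wordProd ω * t * (cs.wordProd ω)⁻¹ = cs.simple i
    · left
      rw [← hi]
      group
    · rw [if_neg hi, add_zero] at h
      exact Or.inr (ih h)

theorem length_mul_lt_of_inversionSign_ne_zero {w t : W} (h : cs.inversionSign w t ≠ 0) :
    cs.length (w * t) < cs.length w := by
  obtain ⟨ω, hω, rfl⟩ := cs.exists_isReduced w
  exact (cs.isRightInversion_of_mem_rightInvSeq hω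
    (cs.mem_rightInvSeq_of_inversionSign_ne_zero h)).2

theorem inversionSign_ne_zero_of_isRightDescent {w : W} {i : B} (h : cs.IsRightDescent w i) :
    cs.inversionSign w (cs.simple i) ≠ 0 := by
  classical
  have h0 : cs.inversionSign (w * cs.simple i) (cs.simple i) = 0 := by
    by_contra hne
    have h1 := cs.length_mul_lt_of_inversionSign_ne_zero hne
    rw [cs.simple_mul_simple_cancel_right] at h1
    exact lt_asymm h h1
  have h1 := cs.inversionSign_mul (w * cs.simple i) (cs.simple i) (cs.simple i)
  rw [cs.simple_mul_simple_cancel_right, inversionSign_simple, if_pos rfl, cs.inv_simple,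
    cs.simple_mul_simple_cancel_right, h0] at h1
  rw [h1]
  decide

/-- The exchange property for a product of two elements. -/
theorem IsRightDescent.mul_cases {cs : CoxeterSystem M W} {v x : W} {i : B}
    (h : cs.IsRightDescent (v * x) i) :
    cs.length (v * (x * cs.simple i * x⁻¹)) < cs.length v ∨ cs.IsRightDescent x i := by
  have h1 := cs.inversionSign_ne_zero_of_isRightDescent h
  rw [inversionSign_mul] at h1
  by_cases h2 : cs.inversionSign x (cs.simple i) = 0
  · rw [h2, zero_add] at h1
    exact Or.inl (cs.length_mul_lt_of_inversionSign_ne_zero h1)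
  · exact Or.inr (cs.length_mul_lt_of_inversionSign_ne_zero h2)

/-! ### Alternating words are reduced -/

theorem wordProd_alternatingWord_succ (i j : B) (n : ℕ) :
    cs.wordProd (alternatingWord i j (n + 1)) =
      cs.wordProd (alternatingWord j i n) * cs.simple j := by
  rw [alternatingWord_succ, wordProd_concat]

theorem inv_wordProd_alternatingWord_mul (i j : B) (n : ℕ) :
    (cs.wordProd (alternatingWord j i n))⁻¹ * cs.wordProd (alternatingWord i j n) =
      (cs.simple i * cs.simple j) ^ n := by
  induction n generalizing i j with
  | zero => simp [alternatingWord]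
  | succ n ih =>
    rw [wordProd_alternatingWord_succ, wordProd_alternatingWord_succ, mul_inv_rev, inv_simple,
      mul_assoc, ← mul_assoc _ (cs.wordProd (alternatingWord j i n)), ih j i, mul_pow_mul,
      pow_succ', mul_assoc]

theorem inversionSign_alternatingWord {i j : B} (hij : i ≠ j) {n : ℕ}
    (hn : M i j = 0 ∨ n < M i j) :
    cs.inversionSign (cs.wordProd (alternatingWord i j n)) (cs.simple i) = 0 := by
  classical
  induction n with
  | zero => simp [alternatingWord]
  | succ n ih =>
    rw [alternatingWord_succ', wordProd_cons, inversionSign_mul, ih (by lia), zero_add,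
      inversionSign_simple, if_neg]
    rw [mul_inv_eq_iff_eq_mul, ← wordProd_alternatingWord_succ, ← wordProd_cons,
      ← alternatingWord_succ', ← inv_mul_eq_one, inv_wordProd_alternatingWord_mul]
    exact cs.simple_mul_simple_pow_ne_one hij n.succ_ne_zero hn

theorem not_isRightDescent_alternatingWord {i j : B} (hij : i ≠ j) {n : ℕ}
    (hn : M i j = 0 ∨ n < M i j) :
    ¬ cs.IsRightDescent (cs.wordProd (alternatingWord i j n)) i := fun h =>
  cs.inversionSign_ne_zero_of_isRightDescent h (cs.inversionSign_alternatingWord hij hn)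

theorem isReduced_alternatingWord {i j : B} (hij : i ≠ j) {n : ℕ}
    (hn : M i j = 0 ∨ n ≤ M i j) : cs.IsReduced (alternatingWord i j n) := by
  induction n generalizing i j with
  | zero => simp [alternatingWord, IsReduced]
  | succ n ih =>
    rw [M.symmetric] at hn
    have h := cs.not_isRightDescent_alternatingWord hij.symm (n := n) (by lia)
    rw [not_isRightDescent_iff, (ih hij.symm (by lia)).eq, length_alternatingWord] at h
    rw [IsReduced, wordProd_alternatingWord_succ, h, length_alternatingWord]

/-! ### The suffix order -/

/-- `x` is the product of a suffix of a reduced word for `v`. -/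
def IsSuffix (x v : W) : Prop := cs.length (v * x⁻¹) + cs.length x = cs.length v

variable {cs}

theorem IsSuffix.refl (v : W) : cs.IsSuffix v v := by simp [IsSuffix]

theorem IsSuffix.one (v : W) : cs.IsSuffix 1 v := by simp [IsSuffix]

theorem IsSuffix.trans {x y z : W} (h : cs.IsSuffix x y) (h' : cs.IsSuffix y z) :
    cs.IsSuffix x z := by
  unfold IsSuffix at *
  have h1 := cs.length_mul_le (z * y⁻¹) (y * x⁻¹)
  have h2 := cs.length_mul_le (z * x⁻¹) x
  rw [inv_mul_cancel_right] at h2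
  rw [← mul_assoc, inv_mul_cancel_right] at h1
  lia

theorem IsSuffix.length_le {x y : W} (h : cs.IsSuffix x y) : cs.length x ≤ cs.length y := by
  unfold IsSuffix at h; lia

theorem IsSuffix.eq_of_length_le {x y : W} (h : cs.IsSuffix x y)
    (hl : cs.length y ≤ cs.length x) : x = y := by
  unfold IsSuffix at h
  have h1 : cs.length (y * x⁻¹) = 0 := by lia
  exact (mul_inv_eq_one.1 (cs.length_eq_zero_iff.1 h1)).symm

theorem IsSuffix.antisymm {x y : W} (h : cs.IsSuffix x y) (h' : cs.IsSuffix y x) : x = y :=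
  h.eq_of_length_le h'.length_le

theorem isSuffix_mul_right_iff {x v y : W} (hx : cs.length (x * y) = cs.length x + cs.length y)
    (hv : cs.length (v * y) = cs.length v + cs.length y) :
    cs.IsSuffix (x * y) (v * y) ↔ cs.IsSuffix x v := by
  unfold IsSuffix
  rw [mul_inv_rev, mul_assoc v, mul_inv_cancel_left, hx, hv]
  lia

theorem isSuffix_mul_left {x y : W} (h : cs.length (y * x) = cs.length y + cs.length x) :
    cs.IsSuffix x (y * x) := by
  rw [IsSuffix, mul_inv_cancel_right, h]

theorem isSuffix_simple_iff {v : W} {i : B} :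
    cs.IsSuffix (cs.simple i) v ↔ cs.IsRightDescent v i := by
  rw [IsSuffix, inv_simple, length_simple, isRightDescent_iff]

theorem IsRightDescent.of_isSuffix {x v : W} {i : B} (hx : cs.IsRightDescent x i)
    (h : cs.IsSuffix x v) : cs.IsRightDescent v i :=
  isSuffix_simple_iff.1 ((isSuffix_simple_iff.2 hx).trans h)

/-- A suffix of `v` without right descent `i` is a suffix of `v * s i` if `i` is a right descent
of `v`. -/
theorem IsSuffix.mul_simple {x v : W} {i : B} (h : cs.IsSuffix x v)
    (hx : ¬ cs.IsRightDescent x i) (hv : cs.IsRightDescent v i) :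
    cs.IsSuffix x (v * cs.simple i) := by
  have hv' : cs.IsRightDescent (v * x⁻¹ * x) i := by rwa [inv_mul_cancel_right]
  have h1 := hv'.mul_cases.resolve_right hx
  rw [isRightDescent_iff] at hv
  unfold IsSuffix at *
  have h2 := cs.length_mul_le (v * cs.simple i * x⁻¹) x
  rw [inv_mul_cancel_right] at h2
  rw [show v * x⁻¹ * (x * cs.simple i * x⁻¹) = v * cs.simple i * x⁻¹ by group] at h1
  lia

/-- An element with two right descents has all admissible alternating words as suffixes. -/
theorem IsRightDescent.exists_alternatingWord {v : W} {i j : B} (hij : i ≠ j)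
    (hi : cs.IsRightDescent v i) (hj : cs.IsRightDescent v j) {n : ℕ}
    (hn : M i j = 0 ∨ n ≤ M i j) :
    cs.IsSuffix (cs.wordProd (alternatingWord i j n)) v := by
  induction n generalizing i j with
  | zero => simpa [alternatingWord] using IsSuffix.one v
  | succ n ih =>
    have hr := (cs.isReduced_alternatingWord hij hn).eq
    rw [length_alternatingWord, wordProd_alternatingWord_succ] at hr
    rw [M.symmetric] at hn
    have hr' := (cs.isReduced_alternatingWord hij.symm (n := n) (by lia)).eq
    rw [length_alternatingWord] at hr'
    have hs := ih hij.symm hj hi (by lia)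
    have hnd := cs.not_isRightDescent_alternatingWord hij.symm (n := n) (by lia)
    have h1 := hs.mul_simple hnd hj
    have h2 : ¬ cs.IsRightDescent (v * cs.simple j) j :=
      cs.isRightDescent_iff_not_isRightDescent_mul.1 hj
    rw [not_isRightDescent_iff] at h2
    rw [wordProd_alternatingWord_succ]
    have := (isSuffix_mul_right_iff (y := cs.simple j) (by rw [hr, hr', length_simple])
      (by rw [h2, length_simple])).2 h1
    rwa [simple_mul_simple_cancel_right] at this

theorem IsRightDescent.matrix_ne_zero {v : W} {i j : B} (hij : i ≠ j)
    (hi : cs.IsRightDescent v i) (hj : cs.IsRightDescent v j) : M i j ≠ 0 := by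
  intro h0
  have h := (hi.exists_alternatingWord hij hj (n := cs.length v + 1) (Or.inl h0)).length_le
  rw [(cs.isReduced_alternatingWord hij (Or.inl h0)).eq, length_alternatingWord] at h
  lia

theorem wordProd_braidWord_symm (i j : B) :
    cs.wordProd (alternatingWord i j (M i j)) = cs.wordProd (alternatingWord j i (M i j)) := by
  have := cs.wordProd_braidWord_eq i j
  rwa [braidWord, braidWord, M.symmetric j i] at this

theorem isRightDescent_braidWord {i j : B} (hij : i ≠ j) (h0 : M i j ≠ 0) :
    cs.IsRightDescent (cs.wordProd (alternatingWord i j (M i j))) j := by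
  have hr := cs.isReduced_alternatingWord hij (n := M i j) (Or.inr le_rfl)
  obtain ⟨n, hn⟩ := Nat.exists_eq_succ_of_ne_zero h0
  rw [hn] at hr ⊢
  rw [IsReduced, length_alternatingWord] at hr
  rw [IsRightDescent, hr, wordProd_alternatingWord_succ, simple_mul_simple_cancel_right]
  exact (cs.length_wordProd_le _).trans_lt (by simp)

/-! ### Joins in the suffix order -/

/-- Two elements with a common upper bound in the suffix order have a join. -/
theorem exists_join {v x y : W} (hx : cs.IsSuffix x v) (hy : cs.IsSuffix y v) :
    ∃ d, cs.IsSuffix d v ∧ cs.IsSuffix x d ∧ cs.IsSuffix y d ∧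
      ∀ c, cs.IsSuffix x c → cs.IsSuffix y c → cs.IsSuffix d c := by
  induction hn : cs.length v using Nat.strong_induction_on generalizing v x y with
  | _ n ih =>
  subst hn
  rcases eq_or_ne x 1 with rfl | hx1
  · exact ⟨y, hy, .one y, .refl y, fun c _ h => h⟩
  rcases eq_or_ne y 1 with rfl | hy1
  · exact ⟨x, hx, .refl x, .one x, fun c h _ => h⟩
  obtain ⟨i, hi⟩ := cs.exists_rightDescent_of_ne_one hx1
  obtain ⟨j, hj⟩ := cs.exists_rightDescent_of_ne_one hy1
  -- joins with a common right factor
  have step : ∀ (z x' y' : W), z ≠ 1 → cs.IsSuffix z x' → cs.IsSuffix z y' →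
      cs.IsSuffix x' v → cs.IsSuffix y' v → ∃ d, cs.IsSuffix d v ∧ cs.IsSuffix x' d ∧
      cs.IsSuffix y' d ∧ ∀ c, cs.IsSuffix x' c → cs.IsSuffix y' c → cs.IsSuffix d c := by
    intro z x' y' hz hzx hzy hxv hyv
    have hzv := hzx.trans hxv
    have hz0 : 0 < cs.length z := Nat.pos_of_ne_zero (mt cs.length_eq_zero_iff.1 hz)
    have cancel : ∀ {a b : W}, cs.IsSuffix z a → cs.IsSuffix z b →
        (cs.IsSuffix (a * z⁻¹) (b * z⁻¹) ↔ cs.IsSuffix a b) := by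
      intro a b ha hb
      rw [← isSuffix_mul_right_iff (y := z), inv_mul_cancel_right, inv_mul_cancel_right] <;>
        rw [inv_mul_cancel_right] <;> symm <;> assumption
    obtain ⟨d, hdv, hxd, hyd, hd⟩ := ih (cs.length (v * z⁻¹))
      (by unfold IsSuffix at hzv; lia) ((cancel hzx hzv).2 hxv) ((cancel hzy hzv).2 hyv) rfl
    have hdz : cs.length (d * z) = cs.length d + cs.length z := by
      unfold IsSuffix at hdv hzv
      have h1 := cs.length_mul_le (v * z⁻¹ * d⁻¹) (d * z)
      rw [← mul_assoc, inv_mul_cancel_right, inv_mul_cancel_right] at h1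
      have h2 := cs.length_mul_le d z
      lia
    have hzd := isSuffix_mul_left hdz
    refine ⟨d * z, ?_, ?_, ?_, fun c hxc hyc => ?_⟩
    · rw [← cancel hzd hzv, mul_inv_cancel_right]; exact hdv
    · rw [← cancel hzx hzd, mul_inv_cancel_right]; exact hxd
    · rw [← cancel hzy hzd, mul_inv_cancel_right]; exact hyd
    · have hzc := hzx.trans hxc
      rw [← cancel hzd hzc, mul_inv_cancel_right]
      exact hd _ ((cancel hzx hzc).2 hxc) ((cancel hzy hzc).2 hyc)
  have hi1 : cs.simple i ≠ 1 := fun h => by simpa [h] using cs.length_simple i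
  have hj1 : cs.simple j ≠ 1 := fun h => by simpa [h] using cs.length_simple j
  rcases eq_or_ne i j with rfl | hij
  · exact step _ x y hi1 (isSuffix_simple_iff.2 hi) (isSuffix_simple_iff.2 hj) hx hy
  set b := cs.wordProd (alternatingWord i j (M i j)) with hb
  have hbv : ∀ c, cs.IsSuffix x c → cs.IsSuffix y c → cs.IsSuffix b c := fun c hxc hyc =>
    (hi.of_isSuffix hxc).exists_alternatingWord hij (hj.of_isSuffix hyc) (Or.inr le_rfl)
  have h0 := (hi.of_isSuffix hx).matrix_ne_zero hij (hj.of_isSuffix hy)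
  have hbj : cs.IsSuffix (cs.simple j) b :=
    isSuffix_simple_iff.2 (isRightDescent_braidWord hij h0)
  have hbi : cs.IsSuffix (cs.simple i) b := by
    rw [hb, wordProd_braidWord_symm, M.symmetric]
    exact isSuffix_simple_iff.2 (isRightDescent_braidWord hij.symm (by rwa [M.symmetric]))
  have hb1 : b ≠ 1 := by
    rintro h
    have := hbj.length_le
    rw [h, length_simple, length_one] at this
    lia
  obtain ⟨p, hpv, hxp, hbp, hp⟩ := step _ x b hi1 (isSuffix_simple_iff.2 hi) hbi hx (hbv v hx hy)
  obtain ⟨q, hqv, hyq, hbq, hq⟩ := step _ y b hj1 (isSuffix_simple_iff.2 hj) hbj hy (hbv v hx hy)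
  obtain ⟨d, hdv, hpd, hqd, hd⟩ := step b p q hb1 hbp hbq hpv hqv
  exact ⟨d, hdv, hxp.trans hpd, hyq.trans hqd, fun c hxc hyc =>
    hd c (hp c hxc (hbv c hxc hyc)) (hq c hyc (hbv c hxc hyc))⟩

/-- A nonempty set of suffixes of `v` that is closed under joins has a greatest element. -/
theorem exists_greatest_of_join_closed (v : W) (P : W → Prop) (h1 : P 1)
    (hP : ∀ x y d, P x → P y → cs.IsSuffix d v → cs.IsSuffix x d → cs.IsSuffix y d →
      (∀ c, cs.IsSuffix x c → cs.IsSuffix y c → cs.IsSuffix d c) → P d) :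
    ∃ u, cs.IsSuffix u v ∧ P u ∧ ∀ x, cs.IsSuffix x v → P x → cs.IsSuffix x u := by
  classical
  have hex : ∃ n, ∃ u, cs.IsSuffix u v ∧ P u ∧ cs.length v - cs.length u = n :=
    ⟨_, 1, .one v, h1, rfl⟩
  obtain ⟨u, huv, hu, hn⟩ := Nat.find_spec hex
  refine ⟨u, huv, hu, fun x hxv hx => ?_⟩
  obtain ⟨d, hdv, hxd, hud, hd⟩ := exists_join hxv huv
  have hmin := Nat.find_min' hex ⟨d, hdv, hP x u d hx hu hdv hxd hud hd, rfl⟩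
  have := hdv.length_le
  have := huv.length_le
  rwa [← hud.eq_of_length_le (by lia)] at hxd

/-- The simple reflections at a set of right descents of `v` have a join. -/
theorem exists_join_simple {v : W} {J : Set B} (hJ : ∀ i ∈ J, cs.IsRightDescent v i) :
    ∃ d, cs.IsSuffix d v ∧ (∀ i ∈ J, cs.IsRightDescent d i) ∧
      ∀ c, (∀ i ∈ J, cs.IsRightDescent c i) → cs.IsSuffix d c := by
  obtain ⟨d, hdv, hd, hmax⟩ := exists_greatest_of_join_closed (cs := cs) v
    (fun d => ∀ c, (∀ i ∈ J, cs.IsRightDescent c i) → cs.IsSuffix d c) (fun c _ => .one c)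
    (fun x y d hx hy _ _ _ h c hc => h c (hx c hc) (hy c hc))
  exact ⟨d, hdv, fun i hi => isSuffix_simple_iff.1 (hmax _ (isSuffix_simple_iff.2 (hJ i hi))
    fun c hc => isSuffix_simple_iff.2 (hc i hi)), hd⟩

/-- Among the suffixes of `v` without right descent `i` there is a greatest one. -/
theorem exists_greatest_not_isRightDescent (v : W) (i : B) :
    ∃ u, cs.IsSuffix u v ∧ ¬ cs.IsRightDescent u i ∧
      ∀ x, cs.IsSuffix x v → ¬ cs.IsRightDescent x i → cs.IsSuffix x u := by
  refine exists_greatest_of_join_closed v _ (cs.not_isRightDescent_one i) ?_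
  intro x y d hx hy _ hxd hyd hd hdi
  have h := (hd _ (hxd.mul_simple hx hdi) (hyd.mul_simple hy hdi)).length_le
  exact absurd hdi (not_lt.2 h)

end CoxeterSystem

/-! ### Artin monoids and their Coxeter groups -/

theorem altWord_eq_alternatingWord (s t : S) (k : ℕ) :
    altWord s t k = if Even k then CoxeterSystem.alternatingWord s t k
      else CoxeterSystem.alternatingWord t s k := by
  induction k generalizing s t with
  | zero => simp [altWord, CoxeterSystem.alternatingWord]
  | succ n ih =>
    rw [altWord, ih]
    by_cases h : Even n <;> simp [h, Nat.even_add_one, CoxeterSystem.alternatingWord_succ']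

/-- The Coxeter matrix with infinite labels encoded by `0`. -/
noncomputable def CoxeterMat.toCoxeterMatrix (M : CoxeterMat S) : CoxeterMatrix S where
  M := Matrix.of fun s t => (M.m s t).toNat
  isSymm := by ext s t; simp [M.symm s t]
  diagonal s := by simp [M.diag]
  off_diagonal s t h := by
    have h2 := M.two_le s t h
    intro h1
    simp only [Matrix.of_apply] at h1
    rcases eq_or_ne (M.m s t) ⊤ with ht | ht
    · simp [ht] at h1
    · rw [← ENat.natCast_toNat ht, h1] at h2
      exact absurd h2 (by decide)

theorem CoxeterMat.toCoxeterMatrix_apply (M : CoxeterMat S) (s t : S) :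
    M.toCoxeterMatrix s t = (M.m s t).toNat := rfl

theorem CoxeterMat.m_eq_toCoxeterMatrix (M : CoxeterMat S) {s t : S}
    (h : M.toCoxeterMatrix s t ≠ 0) : M.m s t = (M.toCoxeterMatrix s t : ℕ∞) := by
  rw [toCoxeterMatrix_apply] at h ⊢
  rw [ENat.natCast_toNat]
  rintro ht
  simp [ht] at h

/-- The Coxeter group of a Coxeter matrix with its standard Coxeter system. -/
noncomputable abbrev CoxeterMat.coxeterSystem (M : CoxeterMat S) :
    CoxeterSystem M.toCoxeterMatrix M.toCoxeterMatrix.Group :=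
  M.toCoxeterMatrix.toCoxeterSystem

namespace ArtinMonoid

open CoxeterSystem

/-- A map to a monoid respects the Artin relations if it does so for the words
`alternatingWord`. -/
theorem lift_eq_lift_of_artinRel {M : CoxeterMat S} {N : Type*} [Monoid N] (f : S → N)
    (hf : ∀ s t, s ≠ t → M.toCoxeterMatrix s t ≠ 0 →
      ((alternatingWord s t (M.toCoxeterMatrix s t)).map f).prod =
        ((alternatingWord t s (M.toCoxeterMatrix s t)).map f).prod)
    (a b : FreeMonoid S) (h : artinRel M a b) : FreeMonoid.lift f a = FreeMonoid.lift f b := by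
  obtain ⟨s, t, k, hst, hk, rfl, rfl⟩ := h
  have hk' : M.toCoxeterMatrix s t = k := by
    rw [CoxeterMat.toCoxeterMatrix_apply, hk, ENat.toNat_natCast]
  have h2 := M.two_le s t hst
  rw [hk] at h2
  have h2 : 2 ≤ k := by exact_mod_cast h2
  have key := hf s t hst (by lia)
  rw [hk'] at key
  simp only [FreeMonoid.lift_apply, FreeMonoid.toList_ofList, altWord_eq_alternatingWord]
  split_ifs
  · exact key
  · exact key.symm

variable (M : CoxeterMat S)

/-- The element of the Artin monoid represented by a word. -/
def wordElt (ω : List S) : ArtinMonoid M := (ω.map (of M)).prod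

@[simp] theorem wordElt_nil : wordElt M [] = 1 := rfl

@[simp] theorem wordElt_singleton (s : S) : wordElt M [s] = of M s := by simp [wordElt]

@[simp] theorem wordElt_append (ω ω' : List S) :
    wordElt M (ω ++ ω') = wordElt M ω * wordElt M ω' := by simp [wordElt]

theorem mk_eq_wordElt (a : FreeMonoid S) :
    PresentedMonoid.mk (artinRel M) a = wordElt M a.toList := by
  induction a using FreeMonoid.inductionOn' with
  | one => rfl
  | of_mul s a ih => rw [map_mul, ih]; simp [wordElt, PresentedMonoid.of]

theorem exists_eq_wordElt (x : ArtinMonoid M) : ∃ ω, x = wordElt M ω := by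
  obtain ⟨a, rfl⟩ := PresentedMonoid.surjective_mk x
  exact ⟨_, mk_eq_wordElt M a⟩

theorem wordElt_alternatingWord {s t : S} (hst : s ≠ t) (h0 : M.toCoxeterMatrix s t ≠ 0) :
    wordElt M (alternatingWord s t (M.toCoxeterMatrix s t)) =
      wordElt M (alternatingWord t s (M.toCoxeterMatrix s t)) := by
  have h : wordElt M (altWord s t (M.toCoxeterMatrix s t)) =
      wordElt M (altWord t s (M.toCoxeterMatrix s t)) := by
    have := PresentedMonoid.mk_eq_mk_of_rel (rels := artinRel M)
      ⟨s, t, M.toCoxeterMatrix s t, hst, M.m_eq_toCoxeterMatrix h0, rfl, rfl⟩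
    rwa [mk_eq_wordElt, mk_eq_wordElt] at this
  rw [altWord_eq_alternatingWord, altWord_eq_alternatingWord] at h
  split_ifs at h
  · exact h
  · exact h.symm

/-! ### The length of an element -/

/-- The word length, as a monoid homomorphism. -/
noncomputable def lengthHom : ArtinMonoid M →* Multiplicative ℕ :=
  PresentedMonoid.lift (fun _ => Multiplicative.ofAdd 1)
    (lift_eq_lift_of_artinRel _ fun s t _ _ => by simp)

/-- The common length of the words representing an element. -/
noncomputable def length (x : ArtinMonoid M) : ℕ := (lengthHom M x).toAdd

theorem length_mul (x y : ArtinMonoid M) : length M (x * y) = length M x + length M y := by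
  simp [length]

theorem length_of (s : S) : length M (of M s) = 1 := by
  simp [length, lengthHom, of]

theorem length_wordElt (ω : List S) : length M (wordElt M ω) = ω.length := by
  induction ω using List.reverseRecOn with
  | nil => simp [length]
  | append_singleton ω s ih => simp [length_mul, length_of, ih]

theorem eq_one_of_length_eq_zero {x : ArtinMonoid M} (h : length M x = 0) : x = 1 := by
  obtain ⟨ω, rfl⟩ := exists_eq_wordElt M x
  rw [length_wordElt, List.length_eq_zero_iff] at h
  rw [h, wordElt_nil]

theorem eq_of_mul_eq_of_mul_eq {d d' e e' : ArtinMonoid M} (h : d = e * d') (h' : d' = e' * d) :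
    d = d' := by
  have h1 := congrArg (length M) h
  have h2 := congrArg (length M) h'
  rw [length_mul] at h1 h2
  rw [h, eq_one_of_length_eq_zero M (x := e) (by lia), one_mul]

/-! ### Matsumoto's theorem and the lift of the Coxeter group -/

/-- Matsumoto's theorem: reduced words for the same element of the Coxeter group represent the
same element of the Artin monoid. -/
theorem wordElt_eq_of_isReduced {ω ω' : List S} (hω : M.coxeterSystem.IsReduced ω)
    (hω' : M.coxeterSystem.IsReduced ω')
    (h : M.coxeterSystem.wordProd ω = M.coxeterSystem.wordProd ω') :
    wordElt M ω = wordElt M ω' := by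
  induction hn : ω.length using Nat.strong_induction_on generalizing ω ω' with
  | _ n ih =>
  subst hn
  have hlen : ω.length = ω'.length := by rw [← hω.eq, ← hω'.eq, h]
  have same : ∀ {α β : List S} {i : S}, M.coxeterSystem.IsReduced (α ++ [i]) →
      M.coxeterSystem.IsReduced (β ++ [i]) →
      M.coxeterSystem.wordProd (α ++ [i]) = M.coxeterSystem.wordProd (β ++ [i]) →
      α.length < ω.length → wordElt M (α ++ [i]) = wordElt M (β ++ [i]) := by
    intro α β i hα hβ hp hl
    have hα' := hα.take α.length
    have hβ' := hβ.take β.length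
    rw [List.take_left] at hα' hβ'
    rw [wordProd_append, wordProd_append] at hp
    rw [wordElt_append, wordElt_append, ih _ hl hα' hβ' (mul_right_cancel hp) rfl]
  rcases List.eq_nil_or_concat' ω with rfl | ⟨α, i, rfl⟩
  · rw [List.length_nil, eq_comm, List.length_eq_zero_iff] at hlen
    rw [hlen]
  rcases List.eq_nil_or_concat' ω' with rfl | ⟨β, j, rfl⟩
  · simp at hlen
  simp only [List.length_append, List.length_singleton] at hlen same
  rcases eq_or_ne i j with rfl | hij
  · exact same hω hω' h (by lia)
  have desc : ∀ {α : List S} {i : S}, M.coxeterSystem.IsReduced (α ++ [i]) →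
      M.coxeterSystem.IsRightDescent (M.coxeterSystem.wordProd (α ++ [i])) i := by
    intro α i hα
    rw [IsRightDescent, hα.eq, wordProd_append, wordProd_singleton,
      simple_mul_simple_cancel_right]
    exact (length_wordProd_le _ _).trans_lt (by simp)
  have hi := desc hω
  have hj := desc hω'
  rw [← h] at hj
  have h0 := hi.matrix_ne_zero hij hj
  obtain ⟨γ, hγ, hγ'⟩ := M.coxeterSystem.exists_isReduced
    (M.coxeterSystem.wordProd (α ++ [i]) * (M.coxeterSystem.wordProd
      (alternatingWord i j (M.toCoxeterMatrix i j)))⁻¹)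
  have hsuf := hi.exists_alternatingWord hij hj (Or.inr le_rfl)
  have hp : M.coxeterSystem.wordProd (γ ++ alternatingWord i j (M.toCoxeterMatrix i j)) =
      M.coxeterSystem.wordProd (α ++ [i]) := by
    rw [wordProd_append, ← hγ', inv_mul_cancel_right]
  have hp' : M.coxeterSystem.wordProd (γ ++ alternatingWord j i (M.toCoxeterMatrix i j)) =
      M.coxeterSystem.wordProd (α ++ [i]) := by
    rw [← hp, wordProd_append, wordProd_append, wordProd_braidWord_symm i j]
  have hred : M.coxeterSystem.IsReduced (γ ++ alternatingWord i j (M.toCoxeterMatrix i j)) := by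
    rw [CoxeterSystem.IsReduced, hp, List.length_append, ← hγ.eq, ← hγ',
      ← (M.coxeterSystem.isReduced_alternatingWord hij (Or.inr le_rfl)).eq]
    exact hsuf.symm
  have hred' : M.coxeterSystem.IsReduced (γ ++ alternatingWord j i (M.toCoxeterMatrix i j)) := by
    rw [CoxeterSystem.IsReduced, hp', ← hp, hred.eq]
    simp
  have hw : wordElt M (γ ++ alternatingWord i j (M.toCoxeterMatrix i j)) =
      wordElt M (γ ++ alternatingWord j i (M.toCoxeterMatrix i j)) := by
    rw [wordElt_append, wordElt_append, wordElt_alternatingWord M hij h0]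
  have hsplit : ∀ a b : S, ∃ δ, alternatingWord a b (M.toCoxeterMatrix i j) = δ ++ [b] := by
    intro a b
    obtain ⟨n, hn⟩ := Nat.exists_eq_succ_of_ne_zero h0
    exact ⟨_, by rw [hn, alternatingWord_succ, List.concat_eq_append]⟩
  obtain ⟨δ, hδ⟩ := hsplit i j
  obtain ⟨δ', hδ'⟩ := hsplit j i
  rw [hδ, ← List.append_assoc] at hp hred hw
  rw [hδ', ← List.append_assoc] at hp' hred' hw
  have hlt : (γ ++ δ).length < α.length + 1 := by
    have := hred.eq
    rw [hp, hω.eq, List.length_append, List.length_append (bs := [j])] at this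
    simp only [List.length_singleton] at this
    lia
  rw [same hω hred' hp'.symm (by lia), ← hw, same hred hω' (hp.trans h) hlt]

/-- The lift of an element of the Coxeter group to the Artin monoid, through any of its reduced
words. -/
noncomputable def coxLift (x : M.toCoxeterMatrix.Group) : ArtinMonoid M :=
  wordElt M (M.coxeterSystem.exists_isReduced x).choose

theorem coxLift_wordProd {ω : List S} (hω : M.coxeterSystem.IsReduced ω) :
    coxLift M (M.coxeterSystem.wordProd ω) = wordElt M ω :=
  have h := (M.coxeterSystem.exists_isReduced (M.coxeterSystem.wordProd ω)).choose_spec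
  wordElt_eq_of_isReduced M h.1 hω h.2.symm

theorem coxLift_one : coxLift M 1 = 1 :=
  coxLift_wordProd M (ω := []) (by simp [CoxeterSystem.IsReduced])

theorem coxLift_simple (s : S) : coxLift M (M.coxeterSystem.simple s) = of M s := by
  have := coxLift_wordProd M (ω := [s])
    (by rw [CoxeterSystem.IsReduced, wordProd_singleton, length_simple, List.length_singleton])
  rwa [wordProd_singleton, wordElt_singleton] at this

theorem coxLift_mul {x y : M.toCoxeterMatrix.Group}
    (h : M.coxeterSystem.length (x * y) = M.coxeterSystem.length x + M.coxeterSystem.length y) :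
    coxLift M (x * y) = coxLift M x * coxLift M y := by
  obtain ⟨ω, hω, rfl⟩ := M.coxeterSystem.exists_isReduced x
  obtain ⟨ω', hω', rfl⟩ := M.coxeterSystem.exists_isReduced y
  rw [coxLift_wordProd M hω, coxLift_wordProd M hω', ← wordElt_append, ← wordProd_append,
    coxLift_wordProd]
  rw [CoxeterSystem.IsReduced, wordProd_append, h, hω.eq, hω'.eq, List.length_append]

theorem coxLift_eq_mul_of_isSuffix {x v : M.toCoxeterMatrix.Group}
    (h : M.coxeterSystem.IsSuffix x v) : coxLift M v = coxLift M (v * x⁻¹) * coxLift M x := by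
  rw [← coxLift_mul, inv_mul_cancel_right]
  rw [inv_mul_cancel_right]
  exact h.symm

/-! ### The greatest simple right divisor -/

/-- The greatest suffix of `v` without right descent `s`. -/
noncomputable def ascentPart (s : S) (v : M.toCoxeterMatrix.Group) : M.toCoxeterMatrix.Group :=
  (exists_greatest_not_isRightDescent (cs := M.coxeterSystem) v s).choose

theorem ascentPart_isSuffix (s : S) (v : M.toCoxeterMatrix.Group) :
    M.coxeterSystem.IsSuffix (ascentPart M s v) v :=
  (exists_greatest_not_isRightDescent (cs := M.coxeterSystem) v s).choose_spec.1

theorem length_ascentPart_mul (s : S) (v : M.toCoxeterMatrix.Group) :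
    M.coxeterSystem.length (ascentPart M s v * M.coxeterSystem.simple s) =
      M.coxeterSystem.length (ascentPart M s v) + 1 :=
  M.coxeterSystem.not_isRightDescent_iff.1
    (exists_greatest_not_isRightDescent (cs := M.coxeterSystem) v s).choose_spec.2.1

theorem isSuffix_ascentPart {s : S} {v x : M.toCoxeterMatrix.Group}
    (h : M.coxeterSystem.IsSuffix x v) (hx : ¬ M.coxeterSystem.IsRightDescent x s) :
    M.coxeterSystem.IsSuffix x (ascentPart M s v) :=
  (exists_greatest_not_isRightDescent (cs := M.coxeterSystem) v s).choose_spec.2.2 x h hx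

/-- Right multiplication by a generator on pairs consisting of an element of the Artin monoid and
a simple factor. -/
noncomputable def headStep (s : S) :
    Function.End (ArtinMonoid M × M.toCoxeterMatrix.Group) := fun p =>
  (p.1 * coxLift M (p.2 * (ascentPart M s p.2)⁻¹), ascentPart M s p.2 * M.coxeterSystem.simple s)

/-- Right multiplication by a word on pairs consisting of an element of the Artin monoid and a
simple factor. -/
noncomputable def headWord (ω : List S) :
    (Function.End (ArtinMonoid M × M.toCoxeterMatrix.Group))ᵐᵒᵖ :=
  (ω.map fun s => MulOpposite.op (headStep M s)).prod

theorem headWord_append_singleton (ω : List S) (s : S)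
    (p : ArtinMonoid M × M.toCoxeterMatrix.Group) :
    (headWord M (ω ++ [s])).unop p = headStep M s ((headWord M ω).unop p) := by
  simp [headWord, Function.End.mul_apply]

theorem headWord_of_isReduced {ω : List S} (hω : M.coxeterSystem.IsReduced ω)
    (m : ArtinMonoid M) (v : M.toCoxeterMatrix.Group) :
    ∃ u, M.coxeterSystem.IsSuffix u v ∧
      M.coxeterSystem.length (u * M.coxeterSystem.wordProd ω) =
        M.coxeterSystem.length u + ω.length ∧
      (∀ y, M.coxeterSystem.IsSuffix y v →
        M.coxeterSystem.length (y * M.coxeterSystem.wordProd ω) =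
          M.coxeterSystem.length y + ω.length → M.coxeterSystem.IsSuffix y u) ∧
      (headWord M ω).unop (m, v) =
        (m * coxLift M (v * u⁻¹), u * M.coxeterSystem.wordProd ω) := by
  induction ω using List.reverseRecOn with
  | nil =>
    refine ⟨v, .refl v, by simp, fun y h _ => h, ?_⟩
    simp [headWord, coxLift_one, Function.End.one_apply]
  | append_singleton ω s ih =>
    have hω' := hω.take ω.length
    rw [List.take_left] at hω'
    obtain ⟨u, huv, hux, hmax, hact⟩ := ih hω'
    have hx := hω'.eq
    have hxs := hω.eq
    rw [headWord_append_singleton, hact]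
    rw [wordProd_append, wordProd_singleton, List.length_append, List.length_singleton] at *
    generalize M.coxeterSystem.wordProd ω = x at *
    generalize ω.length = n at *
    subst hx
    have hxu : M.coxeterSystem.IsSuffix x (u * x) := isSuffix_mul_left hux
    have hxd : ¬ M.coxeterSystem.IsRightDescent x s := by rw [not_isRightDescent_iff, hxs]
    have h1 := ascentPart_isSuffix M s (u * x)
    have h2 := length_ascentPart_mul M s (u * x)
    have h3 := isSuffix_ascentPart M hxu hxd
    have hstep : headStep M s (m * coxLift M (v * u⁻¹), u * x) =
      (m * coxLift M (v * u⁻¹) * coxLift M (u * x * (ascentPart M s (u * x))⁻¹),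
        ascentPart M s (u * x) * M.coxeterSystem.simple s) := rfl
    obtain ⟨u', hu'⟩ : ∃ u', ascentPart M s (u * x) = u' * x :=
      ⟨_, (inv_mul_cancel_right _ x).symm⟩
    have hgreatest := fun y => isSuffix_ascentPart M (s := s) (v := u * x) (x := y)
    rw [hu'] at h1 h2 h3 hstep hgreatest
    have hu'x : M.coxeterSystem.length (u' * x) =
        M.coxeterSystem.length u' + M.coxeterSystem.length x := by
      rw [IsSuffix, mul_inv_cancel_right] at h3
      exact h3.symm
    have hu'u : M.coxeterSystem.IsSuffix u' u := (isSuffix_mul_right_iff hu'x hux).1 h1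
    refine ⟨u', hu'u.trans huv, ?_, fun y hyv hy => ?_, ?_⟩
    · rw [← mul_assoc, h2, hu'x, add_assoc]
    · have h4 := M.coxeterSystem.length_mul_le y x
      have h5 := M.coxeterSystem.length_mul_le (y * x) (M.coxeterSystem.simple s)
      rw [length_simple] at h5
      rw [← mul_assoc] at hy
      have hyx : M.coxeterSystem.length (y * x) =
        M.coxeterSystem.length y + M.coxeterSystem.length x := by lia
      have hyu := hmax y hyv hyx
      refine (isSuffix_mul_right_iff hyx hu'x).1
        (hgreatest _ ((isSuffix_mul_right_iff hyx hux).2 hyu) ?_)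
      rw [not_isRightDescent_iff]
      lia
    · rw [hstep, mul_assoc m, ← coxLift_mul]
      · rw [mul_assoc u' x, show v * u⁻¹ * (u * x * (u' * x)⁻¹) = v * u'⁻¹ by group]
      · have e1 : v * u⁻¹ * (u * x * (u' * x)⁻¹) = v * u'⁻¹ := by group
        have e2 : u * x * (u' * x)⁻¹ = u * u'⁻¹ := by group
        have h6 := hu'u.trans huv
        rw [e1, e2]
        unfold IsSuffix at h6 hu'u huv
        lia

theorem headWord_eq_of_isReduced {ω ω' : List S} (hω : M.coxeterSystem.IsReduced ω)
    (hω' : M.coxeterSystem.IsReduced ω')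
    (h : M.coxeterSystem.wordProd ω = M.coxeterSystem.wordProd ω') :
    headWord M ω = headWord M ω' := by
  have hlen : ω.length = ω'.length := by rw [← hω.eq, ← hω'.eq, h]
  apply MulOpposite.unop_injective
  funext ⟨m, v⟩
  obtain ⟨u, huv, hu, hmax, hact⟩ := headWord_of_isReduced M hω m v
  obtain ⟨u', huv', hlen', hmax', hact'⟩ := headWord_of_isReduced M hω' m v
  rw [h, hlen] at hu hmax
  have huu := (hmax' u huv hu).antisymm (hmax u' huv' hlen')
  rw [hact, hact', huu, h]

/-- The right action of the Artin monoid on pairs consisting of an element of the Artin monoid and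
a simple factor. -/
noncomputable def headHom :
    ArtinMonoid M →* (Function.End (ArtinMonoid M × M.toCoxeterMatrix.Group))ᵐᵒᵖ :=
  PresentedMonoid.lift (fun s => MulOpposite.op (headStep M s))
    (lift_eq_lift_of_artinRel _ fun s t hst _ => headWord_eq_of_isReduced M
      (M.coxeterSystem.isReduced_alternatingWord hst (Or.inr le_rfl))
      (M.coxeterSystem.isReduced_alternatingWord hst.symm
        (Or.inr (M.toCoxeterMatrix.symmetric s t).le))
      (wordProd_braidWord_symm s t))

theorem headHom_wordElt (ω : List S) : headHom M (wordElt M ω) = headWord M ω := by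
  rw [wordElt, map_list_prod, List.map_map, headWord]
  rfl

/-- The decomposition of an element into a remainder and its greatest simple right divisor. -/
noncomputable def headDecomp (x : ArtinMonoid M) : ArtinMonoid M × M.toCoxeterMatrix.Group :=
  (headHom M x).unop (1, 1)

theorem headDecomp_mul (x y : ArtinMonoid M) :
    headDecomp M (x * y) = (headHom M y).unop (headDecomp M x) := by
  rw [headDecomp, map_mul]
  rfl

theorem headDecomp_mul_of (x : ArtinMonoid M) (s : S) :
    headDecomp M (x * of M s) = headStep M s (headDecomp M x) := headDecomp_mul M x _

/-- The greatest element of the Coxeter group whose lift is a right divisor of `x`. -/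
noncomputable def head (x : ArtinMonoid M) : M.toCoxeterMatrix.Group := (headDecomp M x).2

theorem headDecomp_fst_mul_coxLift_head (x : ArtinMonoid M) :
    (headDecomp M x).1 * coxLift M (head M x) = x := by
  obtain ⟨ω, rfl⟩ := exists_eq_wordElt M x
  induction ω using List.reverseRecOn with
  | nil =>
    rw [wordElt_nil, head, headDecomp, map_one]
    exact (one_mul _).trans (coxLift_one M)
  | append_singleton ω s ih =>
    rw [wordElt_append, wordElt_singleton, head, headDecomp_mul_of]
    conv_rhs => rw [← ih]
    rw [head, coxLift_eq_mul_of_isSuffix M (ascentPart_isSuffix M s (headDecomp M _).2)]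
    simp only [headStep]
    rw [coxLift_mul M ((length_ascentPart_mul M s _).trans (by rw [length_simple])),
      coxLift_simple]
    simp only [mul_assoc]

/-- The right divisors of `x` that lift an element of the Coxeter group are the lifts of the
suffixes of `head M x`. -/
theorem exists_eq_mul_coxLift_iff (g : ArtinMonoid M) (x : M.toCoxeterMatrix.Group) :
    (∃ y, g = y * coxLift M x) ↔ M.coxeterSystem.IsSuffix x (head M g) := by
  constructor
  · rintro ⟨y, rfl⟩
    obtain ⟨ω, hω, rfl⟩ := M.coxeterSystem.exists_isReduced x
    obtain ⟨u, -, hu, -, hact⟩ := headWord_of_isReduced M hω (headDecomp M y).1 (headDecomp M y).2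
    rw [head, headDecomp_mul, coxLift_wordProd M hω, headHom_wordElt, hact]
    exact isSuffix_mul_left (by rw [hu, hω.eq])
  · intro h
    refine ⟨(headDecomp M g).1 * coxLift M (head M g * x⁻¹), ?_⟩
    rw [mul_assoc, ← coxLift_eq_mul_of_isSuffix M h, headDecomp_fst_mul_coxLift_head]

theorem mul_of_right_cancel {x y : ArtinMonoid M} {s : S} (h : x * of M s = y * of M s) :
    x = y := by
  have h1 := congrArg (headDecomp M) h
  rw [headDecomp_mul_of, headDecomp_mul_of, headStep, headStep, Prod.mk.injEq] at h1
  obtain ⟨h1, h2⟩ := h1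
  have key : ∀ z : ArtinMonoid M, z = (headDecomp M z).1 *
      coxLift M ((headDecomp M z).2 * (ascentPart M s (headDecomp M z).2)⁻¹) *
      coxLift M (ascentPart M s (headDecomp M z).2) := fun z => by
    rw [mul_assoc, ← coxLift_eq_mul_of_isSuffix M (ascentPart_isSuffix M s _)]
    exact (headDecomp_fst_mul_coxLift_head M z).symm
  rw [key x, key y, h1, mul_right_cancel h2]

/-- Artin monoids are right cancellative. -/
theorem mul_right_cancel' {x y z : ArtinMonoid M} (h : x * z = y * z) : x = y := by
  obtain ⟨ω, rfl⟩ := exists_eq_wordElt M z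
  induction ω using List.reverseRecOn with
  | nil => simpa using h
  | append_singleton ω s ih =>
    rw [wordElt_append, ← mul_assoc, ← mul_assoc, wordElt_singleton] at h
    exact ih (mul_of_right_cancel M h)

/-! ### Least common multiples of generators -/

theorem mem_endLetters_iff (x : ArtinMonoid M) (s : S) :
    s ∈ endLetters M x ↔ M.coxeterSystem.IsRightDescent (head M x) s := by
  rw [← isSuffix_simple_iff, ← exists_eq_mul_coxLift_iff, coxLift_simple]
  rfl

theorem exists_isLeftLcmOfSet_endLetters (x : ArtinMonoid M) :
    ∃ d, IsLeftLcmOfSet M (endLetters M x) d := by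
  obtain ⟨d, -, hd, hmin⟩ := exists_join_simple (cs := M.coxeterSystem) (v := head M x)
    (J := endLetters M x) fun s hs => (mem_endLetters_iff M x s).1 hs
  refine ⟨coxLift M d, fun s hs => ?_, fun c hc => ?_⟩
  · exact ⟨_, by rw [← coxLift_simple]
                 exact coxLift_eq_mul_of_isSuffix M (isSuffix_simple_iff.2 (hd s hs))⟩
  · exact (exists_eq_mul_coxLift_iff M c d).2
      (hmin _ fun s hs => (mem_endLetters_iff M c s).1 (hc s hs))

end ArtinMonoid

theorem IsLeftLcmOfSet.unique {M : CoxeterMat S} {J : Set S} {d d' : ArtinMonoid M}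
    (h : IsLeftLcmOfSet M J d) (h' : IsLeftLcmOfSet M J d') : d = d' := by
  obtain ⟨e, he⟩ := h.2 d' h'.1
  obtain ⟨e', he'⟩ := h'.2 d h.1
  exact ArtinMonoid.eq_of_mul_eq_of_mul_eq M he' he

/-! ### Normal forms -/

/-- `L` is a Brieskorn–Saito normal form of `w`. -/
def IsBrieskornSaitoForm (M : CoxeterMat S) (L : List (Set S)) (w : ArtinMonoid M) : Prop :=
  (∀ I ∈ L, I.Nonempty) ∧
    ∃ (D : List (ArtinMonoid M)) (hlen : L.length = D.length),
      (∀ i : Fin L.length, IsLeftLcmOfSet M (L.get i) (D.get (Fin.cast hlen i))) ∧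
      w = D.prod ∧
      (∀ i : Fin L.length, endLetters M ((D.take (i.1 + 1)).prod) = L.get i)

namespace IsBrieskornSaitoForm

variable {M : CoxeterMat S}

theorem nil_iff {w : ArtinMonoid M} : IsBrieskornSaitoForm M [] w ↔ w = 1 := by
  constructor
  · rintro ⟨-, D, hlen, -, rfl, -⟩
    rw [List.length_eq_zero_iff.1 hlen.symm, List.prod_nil]
  · rintro rfl
    exact ⟨by simp, [], rfl, fun i => i.elim0, rfl, fun i => i.elim0⟩

theorem append_singleton_iff {L : List (Set S)} {I : Set S} {w : ArtinMonoid M} :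
    IsBrieskornSaitoForm M (L ++ [I]) w ↔ I.Nonempty ∧ endLetters M w = I ∧
      ∃ y d, IsLeftLcmOfSet M I d ∧ w = y * d ∧ IsBrieskornSaitoForm M L y := by
  constructor
  · rintro ⟨hne, D, hlen, hlcm, rfl, hend⟩
    rcases List.eq_nil_or_concat' D with rfl | ⟨D, d, rfl⟩
    · simp at hlen
    have hlen' : L.length = D.length := by simpa using hlen
    refine ⟨hne I (by simp), ?_, D.prod, d, ?_, by simp, fun J hJ => hne J (by simp [hJ]), D,
      hlen', fun i => ?_, rfl, fun i => ?_⟩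
    · have := hend ⟨L.length, by simp⟩
      rw [List.take_of_length_le (by simp [hlen'])] at this
      simpa using this
    · simpa [hlen'] using hlcm ⟨L.length, by simp⟩
    · have := hlcm ⟨i, by simp⟩
      simpa [List.getElem_append_left, ← hlen'] using this
    · have := hend ⟨i, by simp⟩
      rw [List.take_append_of_le_length (by have := i.2; simp only; lia)] at this
      simpa [List.getElem_append_left] using this
  · rintro ⟨hI, hw, y, d, hd, rfl, hne, D, hlen, hlcm, rfl, hend⟩
    refine ⟨?_, D ++ [d], by simp [hlen], fun i => ?_, by simp, fun i => ?_⟩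
    · intro J hJ
      rcases List.mem_append.1 hJ with hJ | hJ
      · exact hne J hJ
      · rwa [List.mem_singleton.1 hJ]
    · obtain ⟨i, hi⟩ := i
      rcases lt_or_ge i L.length with h | h
      · simpa [List.getElem_append_left, h, hlen ▸ h] using hlcm ⟨i, h⟩
      · have : i = L.length := by simp at hi; lia
        subst this
        simpa [hlen] using hd
    · obtain ⟨i, hi⟩ := i
      rcases lt_or_ge i L.length with h | h
      · rw [List.take_append_of_le_length (by simp only; lia)]
        simpa [List.getElem_append_left, h] using hend ⟨i, h⟩
      · have : i = L.length := by simp at hi; lia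
        subst this
        rw [List.take_of_length_le (by simp [hlen])]
        simpa using hw

theorem unique {L L' : List (Set S)} {w : ArtinMonoid M} (h : IsBrieskornSaitoForm M L w)
    (h' : IsBrieskornSaitoForm M L' w) : L = L' := by
  have ne_one : ∀ {L : List (Set S)} {I : Set S}, ¬ IsBrieskornSaitoForm M (L ++ [I]) 1 := by
    intro L I h
    obtain ⟨⟨a, ha⟩, hI, -⟩ := append_singleton_iff.1 h
    rw [← hI] at ha
    obtain ⟨y, hy⟩ := ha
    have := congrArg (ArtinMonoid.length M) hy
    rw [ArtinMonoid.length_mul, ArtinMonoid.length_of] at this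
    simp [ArtinMonoid.length] at this
  induction L using List.reverseRecOn generalizing L' w with
  | nil =>
    rw [nil_iff.1 h] at h'
    rcases List.eq_nil_or_concat' L' with rfl | ⟨L', I', rfl⟩
    · rfl
    · exact absurd h' ne_one
  | append_singleton L I ih =>
    rcases List.eq_nil_or_concat' L' with rfl | ⟨L', I', rfl⟩
    · rw [nil_iff.1 h'] at h
      exact absurd h ne_one
    obtain ⟨-, rfl, y, d, hd, hw, hy⟩ := append_singleton_iff.1 h
    obtain ⟨-, rfl, y', d', hd', hw', hy'⟩ := append_singleton_iff.1 h'
    rw [hd.unique hd'] at hw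
    rw [← ArtinMonoid.mul_right_cancel' M (hw.symm.trans hw')] at hy'
    rw [ih hy hy']

theorem exists_form (w : ArtinMonoid M) : ∃ L, IsBrieskornSaitoForm M L w := by
  induction hn : ArtinMonoid.length M w using Nat.strong_induction_on generalizing w with
  | _ n ih =>
  subst hn
  obtain ⟨ω, hω⟩ := ArtinMonoid.exists_eq_wordElt M w
  rcases List.eq_nil_or_concat' ω with rfl | ⟨ω, a, rfl⟩
  · exact ⟨[], nil_iff.2 hω⟩
  have ha : a ∈ endLetters M w := ⟨_, by rw [hω, ArtinMonoid.wordElt_append,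
    ArtinMonoid.wordElt_singleton]⟩
  obtain ⟨d, hd⟩ := ArtinMonoid.exists_isLeftLcmOfSet_endLetters M w
  obtain ⟨y, hy⟩ := hd.2 w fun s hs => hs
  obtain ⟨e, he⟩ := hd.1 a ha
  obtain ⟨L, hL⟩ := ih (ArtinMonoid.length M y) (by
    rw [hy, he, ArtinMonoid.length_mul, ArtinMonoid.length_mul, ArtinMonoid.length_of]; lia)
    y rfl
  exact ⟨L ++ [endLetters M w], append_singleton_iff.2 ⟨⟨a, ha⟩, rfl, y, d, hd, hy, hL⟩⟩

end IsBrieskornSaitoForm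

/-- Brieskorn–Saito normal form. Every element `w` of an Artin monoid has a
unique decomposition `w = Δ_{I_k} ⋯ Δ_{I_1}` into least common multiples of nonempty subsets
of `S`, such that the set of final letters of `Δ_{I_k} ⋯ Δ_{I_j}` is exactly `I_j`. -/
theorem brieskornSaito_normal_form {S : Type*} (M : CoxeterMat S) (w : ArtinMonoid M) :
    ∃! L : List (Set S),
      (∀ I ∈ L, I.Nonempty) ∧
      ∃ (D : List (ArtinMonoid M)) (hlen : L.length = D.length),
        (∀ i : Fin L.length, IsLeftLcmOfSet M (L.get i) (D.get (Fin.cast hlen i))) ∧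
        w = D.prod ∧
        (∀ i : Fin L.length, endLetters M ((D.take (i.1 + 1)).prod) = L.get i) := by
  obtain ⟨L, hL⟩ := IsBrieskornSaitoForm.exists_form w
  exact ⟨L, hL, fun L' hL' => IsBrieskornSaitoForm.unique hL' hL⟩
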